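/- arXiv:1904.01436 — 5 statements merged into one kernel-verified Lean document; each statement's English description precedes it below -/
import Mathlib

section
/- For every k-element subset S ⊆ {1,…,n−1} and every ℓ ≥ 0, the number of permutations p ∈ B_ℓ(n) with ID(p) = S is at most C(ℓ+k−1, k−1)·e^{kπ√(2ℓ/3)}. -/
/-- The inversion set of a permutation `p` of `{0,…,n-1}` (0-indexed version of
`Inv(p) = {(p_j, p_i) : i < j, p_j < p_i}`): pairs `(a, b)` of values with `a < b`
such that `b` precedes `a` in the one-line notation of `p`. -/
def InvSet (n : ℕ) (p : Equiv.Perm (Fin n)) : Finset (Fin n × Fin n) :=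
  Finset.univ.filter (fun x => x.1 < x.2 ∧ p.symm x.2 < p.symm x.1)

/-- The weak (right) Bruhat order: `p ≼ q` iff `Inv(p) ⊆ Inv(q)`. -/
def BLE {n : ℕ} (p q : Equiv.Perm (Fin n)) : Prop :=
  InvSet n p ⊆ InvSet n q

/-- The rank of a permutation in the weak Bruhat order: `rank(p) = |Inv(p)|`. -/
def brank (n : ℕ) (p : Equiv.Perm (Fin n)) : ℕ :=
  (InvSet n p).card

/-- The inverse descent set `ID(p) ⊆ {1,…,n-1}`: `i ∈ ID(p)` iff the (1-indexed)
value `i+1` precedes the value `i` in the one-line notation of `p`.  Here the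
1-indexed value `v ∈ {1,…,n}` corresponds to the element of `Fin n` with `val = v - 1`. -/
def ID (n : ℕ) (p : Equiv.Perm (Fin n)) : Finset ℕ :=
  (Finset.Icc 1 (n - 1)).filter
    (fun i => ∃ a b : Fin n, (a : ℕ) + 1 = i ∧ (b : ℕ) = i ∧ p.symm b < p.symm a)

/-- The generator `g i` is the adjacent transposition interchanging the
(1-indexed) values `i` and `i+1`. -/
def g (n i : ℕ) : Equiv.Perm (Fin n) :=
  if h : 1 ≤ i ∧ i < n then Equiv.swap ⟨i - 1, by omega⟩ ⟨i, h.2⟩ else 1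

/-- A family of permutations is intersecting if any two of its members have
meet different from the identity in the weak Bruhat lattice; equivalently (since the
identity is the minimum), any two members have a common lower bound distinct
from the identity. -/
def BInter (n : ℕ) (P : Set (Equiv.Perm (Fin n))) : Prop :=
  ∀ p ∈ P, ∀ q ∈ P, ∃ r : Equiv.Perm (Fin n), r ≠ 1 ∧ BLE r p ∧ BLE r q

/-- A maximal intersecting family: intersecting, and every permutation
intersecting all its members belongs to it. -/
def MaxBInter (n : ℕ) (P : Set (Equiv.Perm (Fin n))) : Prop :=
  BInter n P ∧ ∀ q : Equiv.Perm (Fin n),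
    (∀ p ∈ P, ∃ r : Equiv.Perm (Fin n), r ≠ 1 ∧ BLE r q ∧ BLE r p) → q ∈ P

/-- The set of `≼`-minimal elements of a family `P`. -/
def minSet (n : ℕ) (P : Set (Equiv.Perm (Fin n))) : Set (Equiv.Perm (Fin n)) :=
  {p | p ∈ P ∧ ∀ q ∈ P, BLE q p → q = p}

/-- `m` is the meet (greatest lower bound) of `p` and `q` in the weak Bruhat order. -/
def IsMeetB (n : ℕ) (p q m : Equiv.Perm (Fin n)) : Prop :=
  BLE m p ∧ BLE m q ∧ ∀ r, BLE r p → BLE r q → BLE r m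

/-- `m` is the join (least upper bound) of the set `S` in the weak Bruhat order. -/
def IsLUBB (n : ℕ) (S : Set (Equiv.Perm (Fin n))) (m : Equiv.Perm (Fin n)) : Prop :=
  (∀ s ∈ S, BLE s m) ∧ ∀ u, (∀ s ∈ S, BLE s u) → BLE m u

/-- For a system `𝒜` of subsets of `{1,…,n-1}`,
`P(𝒜) = {p : A ⊆ ID(p) for some A ∈ 𝒜}`. -/
def PofSystem (n : ℕ) (𝒜 : Set (Finset ℕ)) : Set (Equiv.Perm (Fin n)) :=
  {p | ∃ A ∈ 𝒜, A ⊆ ID n p}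

/-- The generating set system of a family `P`: `{ID(p) : p ∈ min(P)}`. -/
def genSys (n : ℕ) (P : Set (Equiv.Perm (Fin n))) : Set (Finset ℕ) :=
  {A | ∃ p ∈ minSet n P, ID n p = A}

/-- A maximal intersecting antichain of subsets of `{1,…,n-1}`: an antichain
under inclusion, any two members of which meet, such that for every subset `B`
of `{1,…,n-1}` not in the system there is a member `A` with `A ∩ B = ∅` or `A ⊆ B`. -/
def MIA (n : ℕ) (𝒜 : Set (Finset ℕ)) : Prop :=
  (∀ A ∈ 𝒜, ∀ B ∈ 𝒜, A ⊆ B → A = B) ∧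
  (∀ A ∈ 𝒜, ∀ B ∈ 𝒜, (A ∩ B).Nonempty) ∧
  (∀ B : Finset ℕ, B ⊆ Finset.Icc 1 (n - 1) → B ∉ 𝒜 → ∃ A ∈ 𝒜, A ∩ B = ∅ ∨ A ⊆ B)

/-- The Lehmer code of the inverse of `p`: the number of values smaller than `b` that `b`
precedes in the one-line notation of `p`. -/
def lehmerCode {n : ℕ} (p : Equiv.Perm (Fin n)) (b : Fin n) : ℕ :=
  (Finset.univ.filter fun a : Fin n => a < b ∧ p.symm b < p.symm a).card

lemma brank_eq_sum_lehmerCode {n : ℕ} (p : Equiv.Perm (Fin n)) :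
    brank n p = ∑ b, lehmerCode p b := by
  unfold brank InvSet
  rw [Finset.card_eq_sum_card_fiberwise (f := Prod.snd) (t := Finset.univ) (by simp)]
  refine Finset.sum_congr rfl fun b _ => ?_
  refine Finset.card_bij' (fun x _ => x.1) (fun a _ => (a, b)) ?_ ?_ ?_ ?_
  · rintro ⟨a, b'⟩ h
    simp at h ⊢
    obtain ⟨h, rfl⟩ := h
    exact h
  · intro a h
    simpa using h
  · rintro ⟨a, b'⟩ h
    simp at h ⊢
    exact h.2.symm
  · simp

lemma lt_iff_of_lehmerCode_eq {n : ℕ} {p q : Equiv.Perm (Fin n)}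
    (h : lehmerCode p = lehmerCode q) (N : ℕ) :
    ∀ a b : Fin n, a.val < N → b.val < N →
      (p.symm a < p.symm b ↔ q.symm a < q.symm b) := by
  induction N with
  | zero => intro a b ha; omega
  | succ N ih =>
    have inj (r : Equiv.Perm (Fin n)) {a b : Fin n} (hab : a ≠ b) : r.symm a ≠ r.symm b :=
      fun e => hab (r.symm.injective e)
    have key : ∀ a b : Fin n, a < b → b.val = N →
        (p.symm b < p.symm a ↔ q.symm b < q.symm a) := by
      intro a b hab hb
      set A : Finset (Fin n) := {a : Fin n | a < b ∧ p.symm b < p.symm a} with hA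
      set A' : Finset (Fin n) := {a : Fin n | a < b ∧ q.symm b < q.symm a} with hA'
      have hc : A.card = A'.card := congrFun h b
      have hAA : A = A' := by
        by_cases h1 : A ⊆ A'
        · exact Finset.eq_of_subset_of_card_le h1 hc.ge
        by_cases h2 : A' ⊆ A
        · exact (Finset.eq_of_subset_of_card_le h2 hc.le).symm
        exfalso
        obtain ⟨x, hx, hx'⟩ := Finset.not_subset.1 h1
        obtain ⟨y, hy, hy'⟩ := Finset.not_subset.1 h2
        simp only [hA, hA', Finset.mem_filter, Finset.mem_univ, true_and, not_and, not_lt]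
          at hx hx' hy hy'
        have h3 := hx' hx.1
        have h4 := hy' hy.1
        have h5 := (ih y x (by have := hy.1; omega) (by have := hx.1; omega)).1
          (h4.trans_lt hx.2)
        exact absurd (h5.trans_le h3) hy.2.le.not_gt
      have := congrArg (a ∈ ·) hAA
      simpa [hA, hA', hab] using this
    intro a b ha hb
    rcases lt_trichotomy a b with hab | rfl | hab
    · by_cases hbN : b.val = N
      · have h1 := key a b hab hbN
        have h2 := inj p hab.ne
        have h3 := inj q hab.ne
        rw [← not_iff_not, not_lt, not_lt, le_iff_lt_or_eq, le_iff_lt_or_eq, h1]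
        simp [h2.symm, h3.symm]
      · exact ih a b (by omega) (by omega)
    · simp
    · by_cases haN : a.val = N
      · exact key b a hab haN
      · exact ih a b (by omega) (by omega)

lemma lehmerCode_injective (n : ℕ) :
    Function.Injective (lehmerCode : Equiv.Perm (Fin n) → Fin n → ℕ) := by
  intro p q h
  have hm : StrictMono (fun x => q.symm (p x)) := by
    intro x y hxy
    have := lt_iff_of_lehmerCode_eq h n (p x) (p y) (p x).2 (p y).2
    simpa [hxy] using this
  have hid := (hm.range_inj strictMono_id).1
    (((p.trans q.symm).surjective.range_eq).trans Set.range_id.symm)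
  ext x
  have := congrFun hid x
  simp only [id] at this
  rw [Equiv.symm_apply_eq] at this
  rw [this]

lemma symm_le_symm_of_ID {n : ℕ} {p : Equiv.Perm (Fin n)} {a b : Fin n} (hab : a ≤ b)
    (h : ∀ s ∈ ID n p, ¬ (a.val < s ∧ s ≤ b.val)) : p.symm a ≤ p.symm b := by
  obtain ⟨b, hb⟩ := b
  induction b with
  | zero =>
    have : a = ⟨0, hb⟩ := le_antisymm hab (by simp [Fin.le_def])
    rw [this]
  | succ b ih =>
    rcases hab.eq_or_lt with rfl | hlt
    · rfl
    have hlt' : a.val < b + 1 := hlt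
    refine (ih (by omega) (Fin.le_def.2 (by simp; omega))
      fun s hs hh => h s hs ⟨hh.1, by have := hh.2; simp at this ⊢; omega⟩).trans ?_
    by_contra hcon
    refine h (b + 1) ?_ ⟨hlt', le_rfl⟩
    simp only [ID, Finset.mem_filter, Finset.mem_Icc]
    exact ⟨⟨by omega, by omega⟩, ⟨b, by omega⟩, ⟨b + 1, hb⟩, rfl, rfl, not_le.1 hcon⟩

/-- The largest element of `S` that is at most `b`, and `0` if there is none. -/
def blockStart (S : Finset ℕ) (b : ℕ) : ℕ := (S.filter (· ≤ b)).sup id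

lemma not_mem_between_of_blockStart_eq {S : Finset ℕ} {a b : ℕ}
    (h : blockStart S a = blockStart S b) : ∀ s ∈ S, ¬ (a < s ∧ s ≤ b) := by
  rintro s hs ⟨h1, h2⟩
  have h3 : s ≤ blockStart S b :=
    Finset.le_sup (f := id) (Finset.mem_filter.2 ⟨hs, h2⟩)
  have h4 : blockStart S a ≤ a := Finset.sup_le fun s hs => (Finset.mem_filter.1 hs).2
  omega

lemma not_mem_le_of_blockStart_notMem {S : Finset ℕ} {b : ℕ}
    (h : blockStart S b ∉ S) : ∀ s ∈ S, ¬ s ≤ b := by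
  intro s hs hsb
  obtain ⟨x, hx, hx'⟩ := Finset.exists_mem_eq_sup (S.filter (· ≤ b))
    ⟨s, Finset.mem_filter.2 ⟨hs, hsb⟩⟩ id
  apply h
  rw [blockStart, hx']
  exact (Finset.mem_filter.1 hx).1

lemma lehmerCode_le_of_blockStart_eq {n : ℕ} {p : Equiv.Perm (Fin n)} {a b : Fin n}
    (hab : a ≤ b) (h : blockStart (ID n p) a = blockStart (ID n p) b) :
    lehmerCode p b ≤ lehmerCode p a := by
  have hS := not_mem_between_of_blockStart_eq h
  refine Finset.card_le_card fun x hx => ?_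
  simp only [Finset.mem_filter, Finset.mem_univ, true_and] at hx ⊢
  refine ⟨?_, (symm_le_symm_of_ID hab hS).trans_lt hx.2⟩
  by_contra hax
  refine hx.2.not_ge (symm_le_symm_of_ID hx.1.le fun s hs hh => hS s hs ⟨?_, hh.2⟩)
  have : a.val ≤ x.val := not_lt.1 hax
  omega

lemma lehmerCode_eq_zero_of_blockStart_notMem {n : ℕ} {p : Equiv.Perm (Fin n)} {b : Fin n}
    (h : blockStart (ID n p) b ∉ ID n p) : lehmerCode p b = 0 := by
  have hS := not_mem_le_of_blockStart_notMem h
  rw [lehmerCode, Finset.card_eq_zero, Finset.filter_eq_empty_iff]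
  rintro x - ⟨h1, h2⟩
  exact h2.not_ge (symm_le_symm_of_ID h1.le fun s hs hh => hS s hs hh.2)

lemma AntitoneOn.le_of_card_filter_le {α : Type*} [LinearOrder α] {T : Finset α} {f f' : α → ℕ}
    (hf : AntitoneOn f T) (hf' : AntitoneOn f' T)
    (h : ∀ v, 1 ≤ v → (T.filter (v ≤ f ·)).card ≤ (T.filter (v ≤ f' ·)).card)
    {b : α} (hb : b ∈ T) : f b ≤ f' b := by
  by_contra! hlt
  have h1 : T.filter (· ≤ b) ⊆ T.filter (f b ≤ f ·) := fun x hx => by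
    rw [Finset.mem_filter] at hx ⊢
    exact ⟨hx.1, hf hx.1 hb hx.2⟩
  have h2 : T.filter (f b ≤ f' ·) ⊆ T.filter (· < b) := fun x hx => by
    rw [Finset.mem_filter] at hx ⊢
    refine ⟨hx.1, ?_⟩
    by_contra! hbx
    have := hf' hb hx.1 hbx
    omega
  have h3 : T.filter (· < b) ⊂ T.filter (· ≤ b) := by
    refine Finset.ssubset_iff_of_subset (fun x hx => ?_) |>.2 ⟨b, by simp [hb], by simp⟩
    rw [Finset.mem_filter] at hx ⊢
    exact ⟨hx.1, hx.2.le⟩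
  have := h (f b) (by omega)
  have := Finset.card_le_card h1
  have := Finset.card_le_card h2
  have := Finset.card_lt_card h3
  omega

lemma card_filter_le_eq_sum {α : Type*} {T : Finset α} {f : α → ℕ} {L : ℕ}
    (hf : ∀ b ∈ T, f b ≤ L) {v : ℕ} (hv : 1 ≤ v) :
    (T.filter (v ≤ f ·)).card =
      ∑ i : Fin L, if v ≤ i.val + 1 then (T.filter (f · = i.val + 1)).card else 0 := by
  rw [Fin.sum_univ_eq_sum_range
      (fun i => if v ≤ i + 1 then (T.filter (f · = i + 1)).card else 0),
    Finset.card_eq_sum_card_fiberwise (f := fun b => f b - 1) (t := Finset.range L)]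
  · refine Finset.sum_congr rfl fun i _ => ?_
    rw [Finset.filter_filter]
    split_ifs with h
    · congr 1
      refine Finset.filter_congr fun b _ => ?_
      omega
    · rw [Finset.card_eq_zero, Finset.filter_eq_empty_iff]
      intro b _
      omega
  · intro b hb
    simp only [Finset.coe_filter, Set.mem_ofPred_eq, Finset.coe_range, Set.mem_Iio] at hb ⊢
    have := hf b hb.1
    omega

lemma sum_eq_sum_mul_card_filter {α : Type*} {T : Finset α} {f : α → ℕ} {L : ℕ}
    (hf : ∀ b ∈ T, f b ≤ L) :
    ∑ b ∈ T, f b = ∑ i : Fin L, (i.val + 1) * (T.filter (f · = i.val + 1)).card := by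
  rw [Fin.sum_univ_eq_sum_range (fun i => (i + 1) * (T.filter (f · = i + 1)).card)]
  have h0 : ∑ b ∈ T, f b = ∑ v ∈ Finset.range (L + 1), ∑ b ∈ T with f b = v, f b :=
    (Finset.sum_fiberwise_of_maps_to
      (fun b hb => Finset.mem_range.2 (Nat.lt_succ_of_le (hf b hb))) _).symm
  have h1 (v : ℕ) : ∑ b ∈ T with f b = v, f b = v * (T.filter (f · = v)).card := by
    rw [Finset.sum_congr rfl (fun b hb => (Finset.mem_filter.1 hb).2), Finset.sum_const,
      smul_eq_mul, mul_comm]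
  simp_rw [h0, h1]
  rw [Finset.sum_range_succ']
  simp

/-- The number of values in the block of `x.1` whose Lehmer code entry is `x.2 + 1`. -/
def codeMultiplicity {n : ℕ} (S : Finset ℕ) (L : ℕ) (p : Equiv.Perm (Fin n))
    (x : S × Fin L) : ℕ :=
  ((Finset.univ.filter fun b : Fin n => blockStart S b = x.1).filter
    (lehmerCode p · = x.2.val + 1)).card

lemma lehmerCode_le_brank {n : ℕ} (p : Equiv.Perm (Fin n)) (b : Fin n) :
    lehmerCode p b ≤ brank n p := by
  rw [brank_eq_sum_lehmerCode]
  exact Finset.single_le_sum (f := lehmerCode p) (fun _ _ => Nat.zero_le _) (Finset.mem_univ b)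

lemma sum_codeMultiplicity {n : ℕ} (p : Equiv.Perm (Fin n)) :
    ∑ x, (x.2.val + 1) * codeMultiplicity (ID n p) (brank n p) p x = brank n p := by
  conv_rhs => rw [brank_eq_sum_lehmerCode]
  rw [Fintype.sum_prod_type]
  have h1 (s : ID n p) := sum_eq_sum_mul_card_filter
    (T := Finset.univ.filter fun b : Fin n => blockStart (ID n p) b = s)
    (fun b _ => lehmerCode_le_brank p b)
  simp only [codeMultiplicity, ← h1]
  rw [Finset.sum_coe_sort (ID n p) (fun s =>
    ∑ b ∈ Finset.univ.filter fun b : Fin n => blockStart (ID n p) b = s, lehmerCode p b)]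
  rw [Finset.sum_fiberwise_eq_sum_filter]
  refine Finset.sum_subset (Finset.filter_subset _ _) fun b _ hb => ?_
  exact lehmerCode_eq_zero_of_blockStart_notMem (by simpa using hb)

lemma codeMultiplicity_injOn (n L : ℕ) (S : Finset ℕ) :
    Set.InjOn (codeMultiplicity S L) {p : Equiv.Perm (Fin n) | brank n p = L ∧ ID n p = S} := by
  have key : ∀ p q : Equiv.Perm (Fin n), brank n p = L → ID n p = S → brank n q = L →
      ID n q = S → codeMultiplicity S L p = codeMultiplicity S L q →
      ∀ b, lehmerCode p b ≤ lehmerCode q b := by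
    intro p q hp hpS hq hqS h b
    by_cases hb : blockStart S b ∈ S
    · have anti (r : Equiv.Perm (Fin n)) (hr : ID n r = S) : AntitoneOn (lehmerCode r)
          (Finset.univ.filter fun c : Fin n => blockStart S c = blockStart S b) := by
        intro x hx y hy hxy
        simp only [Finset.coe_filter, Finset.mem_univ, true_and, Set.mem_ofPred_eq] at hx hy
        exact lehmerCode_le_of_blockStart_eq hxy (by rw [hr, hx, hy])
      refine (anti p hpS).le_of_card_filter_le (anti q hqS) (fun v hv => le_of_eq ?_) (by simp)
      rw [card_filter_le_eq_sum (L := L) (fun b _ => hp ▸ lehmerCode_le_brank p b) hv,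
        card_filter_le_eq_sum (L := L) (fun b _ => hq ▸ lehmerCode_le_brank q b) hv]
      refine Finset.sum_congr rfl fun i _ => ?_
      have := congrFun h (⟨blockStart S b, hb⟩, i)
      simp only [codeMultiplicity] at this
      rw [this]
    · rw [lehmerCode_eq_zero_of_blockStart_notMem (by rwa [hpS])]
      exact Nat.zero_le _
  rintro p ⟨hp, hpS⟩ q ⟨hq, hqS⟩ h
  exact lehmerCode_injective n (funext fun b => le_antisymm
    (key p q hp hpS hq hqS h b) (key q p hq hqS hp hpS h.symm b))

lemma card_mul_pow_le {n ℓ : ℕ} {S : Finset ℕ} {x : ℝ} (hx0 : 0 ≤ x) (hx1 : x < 1) :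
    (Nat.card {p : Equiv.Perm (Fin n) | brank n p = ℓ ∧ ID n p = S} : ℝ) * x ^ ℓ ≤
      (∏ i : Fin ℓ, (1 - x ^ (i.val + 1))⁻¹) ^ S.card := by
  classical
  set P : Finset (Equiv.Perm (Fin n)) :=
    Finset.univ.filter fun p => brank n p = ℓ ∧ ID n p = S with hP
  have hcard : Nat.card {p : Equiv.Perm (Fin n) | brank n p = ℓ ∧ ID n p = S} = P.card := by
    rw [Nat.card_eq_fintype_card, Fintype.card_subtype]
    rfl
  have hmem {p} (hp : p ∈ P) : brank n p = ℓ ∧ ID n p = S := (Finset.mem_filter.1 hp).2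
  have hsum {p} (hp : p ∈ P) :
      ∑ y, (y.2.val + 1) * codeMultiplicity S ℓ p y = ℓ := by
    obtain ⟨rfl, rfl⟩ := hmem hp
    exact sum_codeMultiplicity p
  calc (Nat.card {p : Equiv.Perm (Fin n) | brank n p = ℓ ∧ ID n p = S} : ℝ) * x ^ ℓ
      = ∑ p ∈ P, ∏ y, (x ^ (y.2.val + 1)) ^ codeMultiplicity S ℓ p y := by
        rw [hcard, ← nsmul_eq_mul, ← Finset.sum_const]
        refine Finset.sum_congr rfl fun p hp => ?_
        simp_rw [← pow_mul]
        rw [Finset.prod_pow_eq_pow_sum, hsum hp]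
    _ = ∑ m ∈ P.image (codeMultiplicity S ℓ), ∏ y : S × Fin ℓ, (x ^ (y.2.val + 1)) ^ m y := by
        rw [Finset.sum_image fun p hp q hq =>
          codeMultiplicity_injOn n ℓ S (hmem hp) (hmem hq)]
    _ ≤ ∑ m ∈ Fintype.piFinset fun _ : S × Fin ℓ => Finset.range (ℓ + 1),
          ∏ y : S × Fin ℓ, (x ^ (y.2.val + 1)) ^ m y := by
        refine Finset.sum_le_sum_of_subset_of_nonneg (fun m hm => ?_) fun m _ _ => by positivity
        obtain ⟨p, hp, rfl⟩ := Finset.mem_image.1 hm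
        rw [Fintype.mem_piFinset]
        intro y
        have := Finset.single_le_sum (f := fun y => (y.2.val + 1) * codeMultiplicity S ℓ p y)
          (fun _ _ => Nat.zero_le _) (Finset.mem_univ y)
        rw [hsum hp] at this
        rw [Finset.mem_range]
        nlinarith
    _ = ∏ y : S × Fin ℓ, ∑ j ∈ Finset.range (ℓ + 1), (x ^ (y.2.val + 1)) ^ j :=
        (Finset.prod_univ_sum _ _).symm
    _ ≤ ∏ y : S × Fin ℓ, (1 - x ^ (y.2.val + 1))⁻¹ := by
        refine Finset.prod_le_prod (fun y _ => by positivity) fun y _ => ?_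
        have h1 : x ^ (y.2.val + 1) < 1 := pow_lt_one₀ hx0 hx1 (by omega)
        have h0 : 0 ≤ x ^ (y.2.val + 1) := by positivity
        rw [← tsum_geometric_of_lt_one h0 h1]
        exact (summable_geometric_of_lt_one h0 h1).sum_le_tsum _ fun _ _ => by positivity
    _ = (∏ i : Fin ℓ, (1 - x ^ (i.val + 1))⁻¹) ^ S.card := by
        rw [Fintype.prod_prod_type]
        simp

lemma sum_exp_neg_mul_le {u : ℝ} (hu : 0 < u) (L : ℕ) :
    ∑ i : Fin L, Real.exp (-u) ^ (i.val + 1) ≤ 1 / u := by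
  set y := Real.exp (-u) with hy
  have hy0 : 0 < y := Real.exp_pos _
  have hy1 : y < 1 := by simpa [hy] using hu
  have h1 : ∑ i : Fin L, y ^ (i.val + 1) ≤ y / (1 - y) := by
    rw [Fin.sum_univ_eq_sum_range (fun i => y ^ (i + 1))]
    simp_rw [pow_succ']
    rw [← Finset.mul_sum, div_eq_mul_inv, ← tsum_geometric_of_lt_one hy0.le hy1]
    exact mul_le_mul_of_nonneg_left
      ((summable_geometric_of_lt_one hy0.le hy1).sum_le_tsum _ fun _ _ => by positivity) hy0.le
  refine h1.trans ?_
  rw [div_le_div_iff₀ (by linarith) hu]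
  have h2 : y * Real.exp u = 1 := by rw [hy, ← Real.exp_add]; simp
  nlinarith [Real.add_one_le_exp u]

lemma prod_inv_one_sub_exp_le {t : ℝ} (ht : 0 < t) (L : ℕ) :
    ∏ i : Fin L, (1 - Real.exp (-t) ^ (i.val + 1))⁻¹ ≤ Real.exp (Real.pi ^ 2 / 6 / t) := by
  set x := Real.exp (-t) with hx
  have hx0 : 0 < x := Real.exp_pos _
  have hx1 : x < 1 := by simpa [hx] using ht
  have hpow (i : ℕ) : x ^ (i + 1) < 1 := pow_lt_one₀ hx0.le hx1 (by omega)
  have hpos (i : ℕ) : 0 < 1 - x ^ (i + 1) := by linarith [hpow i]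
  have hlog : HasSum (fun m : ℕ => ∑ i : Fin L, (x ^ (i.val + 1)) ^ (m + 1) / ((m : ℝ) + 1))
      (∑ i : Fin L, -Real.log (1 - x ^ (i.val + 1))) :=
    hasSum_sum fun i _ => Real.hasSum_pow_div_log_of_abs_lt_one
      (by rw [abs_of_pos (by positivity)]; exact hpow i)
  have hzeta : HasSum (fun m : ℕ => 1 / ((m : ℝ) + 1) ^ 2 / t) (Real.pi ^ 2 / 6 / t) := by
    have := (hasSum_nat_add_iff' 1).2 hasSum_zeta_two
    simpa using this.div_const t
  have hle := hasSum_le (fun m => ?_) hlog hzeta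
  · calc ∏ i : Fin L, (1 - x ^ (i.val + 1))⁻¹
        = Real.exp (∑ i : Fin L, -Real.log (1 - x ^ (i.val + 1))) := by
          rw [Real.exp_sum]
          refine Finset.prod_congr rfl fun i _ => ?_
          rw [Real.exp_neg, Real.exp_log (hpos i)]
      _ ≤ _ := Real.exp_le_exp.2 hle
  · have hm : (0 : ℝ) < (m : ℝ) + 1 := by positivity
    have h := sum_exp_neg_mul_le (mul_pos hm ht) L
    have hxm : Real.exp (-(((m : ℝ) + 1) * t)) = x ^ (m + 1) := by
      rw [hx, ← Real.exp_nat_mul]; push_cast; ring_nf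
    rw [hxm] at h
    rw [← Finset.sum_div]
    calc (∑ i : Fin L, (x ^ (i.val + 1)) ^ (m + 1)) / ((m : ℝ) + 1)
        ≤ (1 / (((m : ℝ) + 1) * t)) / ((m : ℝ) + 1) := by
          refine div_le_div_of_nonneg_right (le_of_eq_of_le ?_ h) hm.le
          exact Finset.sum_congr rfl fun i _ => pow_right_comm _ _ _
      _ = 1 / ((m : ℝ) + 1) ^ 2 / t := by field_simp

lemma card_le_one_of_eq_zero {n ℓ : ℕ} {S : Finset ℕ} (h : ℓ = 0 ∨ S = ∅) :
    Nat.card {p : Equiv.Perm (Fin n) | brank n p = ℓ ∧ ID n p = S} ≤ 1 := by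
  rw [Finite.card_le_one_iff_subsingleton, Set.subsingleton_coe]
  have : IsEmpty (S × Fin ℓ) := by
    rcases h with rfl | rfl <;> infer_instance
  exact fun p hp q hq => codeMultiplicity_injOn n ℓ S hp hq (Subsingleton.elim _ _)

/-- The multiplicity of a `k`-set of generators at level `ℓ` of the weak Bruhat
lattice `B(n)` is at most `C(ℓ+k-1, k-1) · e^{kπ√(2ℓ/3)}`. -/
theorem stmt_1 (n ℓ k : ℕ) (S : Finset ℕ) (hS : S ⊆ Finset.Icc 1 (n - 1))
    (hSk : S.card = k) :
    (Nat.card {p : Equiv.Perm (Fin n) | brank n p = ℓ ∧ ID n p = S} : ℝ) ≤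
      (Nat.choose (ℓ + k - 1) (k - 1) : ℝ) *
        Real.exp (k * Real.pi * Real.sqrt (2 * ℓ / 3)) := by
  have hchoose : (1 : ℝ) ≤ Nat.choose (ℓ + k - 1) (k - 1) :=
    Nat.one_le_cast.2 (Nat.choose_pos (by omega))
  refine le_trans ?_ (le_mul_of_one_le_left (Real.exp_pos _).le hchoose)
  by_cases h : ℓ = 0 ∨ S = ∅
  · exact (Nat.cast_le_one.2 (card_le_one_of_eq_zero h)).trans
      (Real.one_le_exp (by positivity))
  push Not at h
  have hℓ : (0 : ℝ) < ℓ := Nat.cast_pos.2 (Nat.pos_of_ne_zero h.1)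
  have hk : (1 : ℝ) ≤ k := Nat.one_le_cast.2 (hSk ▸ h.2.card_pos)
  set r := Real.sqrt (2 * ℓ / 3) with hr
  have hr0 : 0 < r := Real.sqrt_pos.2 (by positivity)
  have hr2 : r ^ 2 = 2 * ℓ / 3 := Real.sq_sqrt (by positivity)
  set t := Real.pi / (3 * r) with ht
  have hπ := Real.pi_pos
  have ht0 : 0 < t := by positivity
  have hℓt : ℓ * t = Real.pi * r / 2 := by
    have : (ℓ : ℝ) = 3 * r ^ 2 / 2 := by linarith
    rw [this, ht]; field_simp
  have hπt : Real.pi ^ 2 / 6 / t = Real.pi * r / 2 := by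
    rw [ht]; field_simp; norm_num
  have hmain := card_mul_pow_le (n := n) (ℓ := ℓ) (S := S) (Real.exp_pos (-t)).le
    (by simpa using ht0)
  have hprod := pow_le_pow_left₀
    (Finset.prod_nonneg fun i _ => inv_nonneg.2 (sub_nonneg.2
      (pow_le_one₀ (Real.exp_pos (-t)).le (by simpa using ht0.le))))
    (prod_inv_one_sub_exp_le ht0 ℓ) k
  rw [hSk] at hmain
  have hfin := hmain.trans hprod
  rw [← Real.exp_nat_mul, ← Real.exp_nat_mul, ← le_div_iff₀ (Real.exp_pos _),
    ← Real.exp_sub] at hfin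
  refine hfin.trans (Real.exp_le_exp.2 ?_)
  rw [hπt, mul_neg, hℓt]
  nlinarith [mul_pos hπ hr0]
end

section
/- Call a set A ⊆ {1,…,n−1} separated if there is no i with both i ∈ A and i+1 ∈ A. If a permutation p ∈ B_ℓ(n) satisfies |ID(p)| = ℓ, then ID(p) is a separated set. -/
/-- Each inverse descent is the larger value of some inversion. -/
theorem ID_subset_image_InvSet (n : ℕ) (p : Equiv.Perm (Fin n)) :
    ID n p ⊆ (InvSet n p).image (fun x => (x.2 : ℕ)) := by
  intro i hi
  obtain ⟨-, a, b, ha, hb, hab⟩ := Finset.mem_filter.1 hi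
  refine Finset.mem_image.2 ⟨(a, b), Finset.mem_filter.2 ⟨Finset.mem_univ _, ?_, hab⟩, hb⟩
  exact Fin.lt_def.2 (by simp only; omega)

/-- If a permutation at level `ℓ` of `B(n)` has an inverse descent set of size `ℓ`,
then its inverse descent set is separated: it contains no two consecutive integers. -/
theorem stmt_2 (n ℓ : ℕ) (p : Equiv.Perm (Fin n)) (hrank : brank n p = ℓ)
    (hcard : (ID n p).card = ℓ) :
    ∀ i, i ∈ ID n p → i + 1 ∉ ID n p := by
  intro i hi hi'
  have hinj : Set.InjOn (fun x : Fin n × Fin n => (x.2 : ℕ)) (InvSet n p) := by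
    refine Finset.card_image_iff.1 (le_antisymm Finset.card_image_le ?_)
    have h := Finset.card_le_card (ID_subset_image_InvSet n p)
    rwa [hcard, ← hrank] at h
  obtain ⟨-, a, b, ha, hb, hab⟩ := Finset.mem_filter.1 hi
  obtain ⟨-, b', c, hb', hc, hbc⟩ := Finset.mem_filter.1 hi'
  obtain rfl : b' = b := Fin.ext (by omega)
  have hmem₁ : (b', c) ∈ InvSet n p :=
    Finset.mem_filter.2 ⟨Finset.mem_univ _, Fin.lt_def.2 (by simp only; omega), hbc⟩
  have hmem₂ : (a, c) ∈ InvSet n p :=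
    Finset.mem_filter.2 ⟨Finset.mem_univ _, Fin.lt_def.2 (by simp only; omega), hbc.trans hab⟩
  have hba : b' = a := congrArg Prod.fst (hinj hmem₁ hmem₂ rfl)
  rw [hba] at hb
  omega
end

section
/- For all p, q ∈ Sym(n), the meet in the weak Bruhat lattice satisfies ID(p ∧ q) = ID(p) ∩ ID(q). -/
theorem mem_InvSet {n : ℕ} {p : Equiv.Perm (Fin n)} {a b : Fin n} :
    (a, b) ∈ InvSet n p ↔ a < b ∧ p.symm b < p.symm a := by
  simp [InvSet]

theorem BLE_iff {n : ℕ} {p q : Equiv.Perm (Fin n)} :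
    BLE p q ↔ ∀ a b : Fin n, a < b → p.symm b < p.symm a → q.symm b < q.symm a := by
  constructor
  · intro h a b hab hp
    exact (mem_InvSet.1 (h (mem_InvSet.2 ⟨hab, hp⟩))).2
  · rintro h ⟨a, b⟩ hx
    obtain ⟨hab, hp⟩ := mem_InvSet.1 hx
    exact mem_InvSet.2 ⟨hab, h a b hab hp⟩

/-- Every strict total order on `Fin n` is the order of positions of some permutation. -/
theorem exists_perm_symm_lt_iff {n : ℕ} (R : Fin n → Fin n → Prop)
    (irrefl : ∀ a, ¬ R a a) (trans : ∀ a b c, R a b → R b c → R a c)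
    (total : ∀ a b, a ≠ b → R a b ∨ R b a) :
    ∃ m : Equiv.Perm (Fin n), ∀ a b, m.symm a < m.symm b ↔ R a b := by
  classical
  let below : Fin n → Finset (Fin n) := fun a => Finset.univ.filter (fun c => R c a)
  have card_lt : ∀ a, (below a).card < n := by
    intro a
    have h : below a ⊂ Finset.univ :=
      Finset.ssubset_univ_iff.2 fun h => by
        have ha : a ∈ below a := h ▸ Finset.mem_univ a
        exact irrefl a (by simpa [below] using ha)
    simpa using Finset.card_lt_card h
  let pos : Fin n → Fin n := fun a => ⟨(below a).card, card_lt a⟩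
  have mono : ∀ a b, R a b → pos a < pos b := by
    intro a b hab
    change (below a).card < (below b).card
    refine Finset.card_lt_card (Finset.ssubset_iff_of_subset ?_ |>.2 ⟨a, ?_, ?_⟩)
    · intro c hc
      simp only [below, Finset.mem_filter, Finset.mem_univ, true_and] at hc ⊢
      exact trans c a b hc hab
    · simpa [below] using hab
    · simpa [below] using irrefl a
  have inj : Function.Injective pos := by
    intro a b hab
    by_contra hne
    rcases total a b hne with h | h
    · exact (mono a b h).ne hab
    · exact (mono b a h).ne hab.symm
  refine ⟨(Equiv.ofBijective pos (Finite.injective_iff_bijective.1 inj)).symm, fun a b => ?_⟩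
  simp only [Equiv.symm_symm, Equiv.ofBijective_apply]
  refine ⟨fun h => ?_, mono a b⟩
  by_contra hR
  rcases eq_or_ne a b with rfl | hne
  · exact lt_irrefl _ h
  · exact lt_asymm h (mono b a ((total a b hne).resolve_left hR))

/-- A pair of values that is a non-inversion of `p` or of `q`. -/
def NonInvEither {n : ℕ} (p q : Equiv.Perm (Fin n)) (a b : Fin n) : Prop :=
  a < b ∧ (p.symm a < p.symm b ∨ q.symm a < q.symm b)

theorem lt_of_transGen_nonInvEither {n : ℕ} {p q : Equiv.Perm (Fin n)} {a b : Fin n}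
    (h : Relation.TransGen (NonInvEither p q) a b) : a < b := by
  induction h with
  | single h => exact h.1
  | tail _ h ih => exact ih.trans h.1

theorem NonInvEither.split {n : ℕ} {p q : Equiv.Perm (Fin n)} {a b c : Fin n}
    (h : NonInvEither p q a c) (hab : a < b) (hbc : b < c) :
    NonInvEither p q a b ∨ NonInvEither p q b c := by
  rcases h with ⟨_, h | h⟩
  · rcases lt_or_ge (p.symm a) (p.symm b) with h' | h'
    · exact Or.inl ⟨hab, Or.inl h'⟩
    · exact Or.inr ⟨hbc, Or.inl (h'.trans_lt h)⟩
  · rcases lt_or_ge (q.symm a) (q.symm b) with h' | h'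
    · exact Or.inl ⟨hab, Or.inr h'⟩
    · exact Or.inr ⟨hbc, Or.inr (h'.trans_lt h)⟩

theorem transGen_nonInvEither_split {n : ℕ} {p q : Equiv.Perm (Fin n)} {a b c : Fin n}
    (h : Relation.TransGen (NonInvEither p q) a c) (hab : a < b) (hbc : b < c) :
    Relation.TransGen (NonInvEither p q) a b ∨ Relation.TransGen (NonInvEither p q) b c := by
  induction h using Relation.TransGen.head_induction_on with
  | single h => exact (h.split hab hbc).imp .single .single
  | @head a x hax hxc ih =>
    rcases lt_trichotomy b x with hbx | rfl | hxb
    · exact (hax.split hab hbx).imp .single fun h => .head h hxc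
    · exact Or.inr hxc
    · exact (ih hxb).imp_left fun h => .head hax h

theorem exists_isMeetB {n : ℕ} (p q : Equiv.Perm (Fin n)) : ∃ m, IsMeetB n p q m := by
  let T := Relation.TransGen (NonInvEither p q)
  have T_lt : ∀ {a b}, T a b → a < b := lt_of_transGen_nonInvEither
  have T_trans : ∀ {a b c}, T a b → T b c → T a c := Relation.TransGen.trans
  have T_split : ∀ {a b c}, T a c → a < b → b < c → T a b ∨ T b c :=
    transGen_nonInvEither_split
  obtain ⟨m, hm⟩ := exists_perm_symm_lt_iff (fun a b => T a b ∨ (b < a ∧ ¬ T b a))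
    (by
      rintro a (h | h)
      · exact lt_irrefl _ (T_lt h)
      · exact lt_irrefl _ h.1)
    (by
      rintro a b c (hab | ⟨hba, hab⟩) (hbc | ⟨hcb, hbc⟩)
      · exact Or.inl (T_trans hab hbc)
      · rcases lt_trichotomy a c with h | rfl | h
        · exact Or.inl ((T_split hab h hcb).resolve_right hbc)
        · exact absurd hab hbc
        · exact Or.inr ⟨h, fun h' => hbc (T_trans h' hab)⟩
      · rcases lt_trichotomy a c with h | rfl | h
        · exact Or.inl ((T_split hbc hba h).resolve_left hab)
        · exact absurd hbc hab
        · exact Or.inr ⟨h, fun h' => hab (T_trans hbc h')⟩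
      · exact Or.inr ⟨hcb.trans hba, fun h => (T_split h hcb hba).elim hbc hab⟩)
    (by
      intro a b hne
      by_cases h : T a b
      · exact Or.inl (Or.inl h)
      by_cases h' : T b a
      · exact Or.inr (Or.inl h')
      rcases hne.lt_or_gt with hlt | hlt
      · exact Or.inr (Or.inr ⟨hlt, h⟩)
      · exact Or.inl (Or.inr ⟨hlt, h'⟩))
  have hinv : ∀ a b, a < b → m.symm b < m.symm a → ¬ NonInvEither p q a b := by
    intro a b hab h hN
    rcases (hm b a).1 h with h | h
    · exact lt_asymm hab (T_lt h)
    · exact h.2 (.single hN)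
  refine ⟨m, BLE_iff.2 ?_, BLE_iff.2 ?_, fun r hrp hrq => BLE_iff.2 ?_⟩
  · intro a b hab h
    refine lt_of_le_of_ne (not_lt.1 fun h' => hinv a b hab h ⟨hab, Or.inl h'⟩) ?_
    exact p.symm.injective.ne hab.ne'
  · intro a b hab h
    refine lt_of_le_of_ne (not_lt.1 fun h' => hinv a b hab h ⟨hab, Or.inr h'⟩) ?_
    exact q.symm.injective.ne hab.ne'
  · intro a b hab h
    refine (hm b a).2 (Or.inr ⟨hab, fun hT => lt_asymm h ?_⟩)
    have step : ∀ {x y}, NonInvEither p q x y → r.symm x < r.symm y := by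
      rintro x y ⟨hxy, hpq⟩
      refine lt_of_le_of_ne (not_lt.1 fun h' => ?_) (r.symm.injective.ne hxy.ne)
      rcases hpq with h'' | h''
      · exact lt_asymm h'' (BLE_iff.1 hrp x y hxy h')
      · exact lt_asymm h'' (BLE_iff.1 hrq x y hxy h')
    clear h hab
    induction hT with
    | single h => exact step h
    | tail _ h ih => exact ih.trans (step h)

/-- An adjacent transposition of values lies below every permutation inverting these values. -/
theorem swap_BLE {n : ℕ} {p : Equiv.Perm (Fin n)} {a b : Fin n} (hab : (a : ℕ) + 1 = b)
    (h : p.symm b < p.symm a) : BLE (Equiv.swap a b) p := by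
  refine BLE_iff.2 fun c d hcd hs => ?_
  have hcd' : c = a ∧ d = b := by
    rw [Equiv.symm_swap, Equiv.swap_apply_def, Equiv.swap_apply_def] at hs
    simp only [Fin.ext_iff, Fin.lt_def] at *
    split_ifs at hs <;> omega
  rwa [hcd'.1, hcd'.2]

theorem ID_mono {n : ℕ} {p q : Equiv.Perm (Fin n)} (h : BLE p q) : ID n p ⊆ ID n q := by
  intro i hi
  simp only [ID, Finset.mem_filter] at hi ⊢
  obtain ⟨hi, a, b, ha, hb, hp⟩ := hi
  exact ⟨hi, a, b, ha, hb, BLE_iff.1 h a b (Fin.lt_def.2 (by omega)) hp⟩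

theorem ID_of_isMeetB {n : ℕ} {p q m : Equiv.Perm (Fin n)} (hm : IsMeetB n p q m) :
    ID n m = ID n p ∩ ID n q := by
  refine (Finset.subset_inter (ID_mono hm.1) (ID_mono hm.2.1)).antisymm fun i hi => ?_
  simp only [ID, Finset.mem_inter, Finset.mem_filter] at hi ⊢
  obtain ⟨⟨hi, a, b, ha, hb, hp⟩, -, a', b', ha', hb', hq⟩ := hi
  obtain rfl : a' = a := Fin.ext (by omega)
  obtain rfl : b' = b := Fin.ext (by omega)
  have hab : (a' : ℕ) + 1 = b' := by omega
  have hlt : a' < b' := Fin.lt_def.2 (by omega)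
  refine ⟨hi, a', b', ha, hb, ?_⟩
  refine BLE_iff.1 (hm.2.2 _ (swap_BLE hab hp) (swap_BLE hab hq)) a' b' hlt ?_
  simpa using hlt

/-- The meet in the weak Bruhat lattice exists and satisfies
`ID(p ∧ q) = ID(p) ∩ ID(q)`. -/
theorem stmt_4 (n : ℕ) (p q : Equiv.Perm (Fin n)) :
    (∃ m, IsMeetB n p q m) ∧
    (∀ m, IsMeetB n p q m → ID n m = ID n p ∩ ID n q) := by
  exact ⟨exists_isMeetB p q, fun _ hm => ID_of_isMeetB hm⟩
end

section
/- Let P ⊆ B(n) be an intersecting family and let A = {ID(p) : p ∈ min(P)}. Then A is an intersecting set system (any two members meet). Moreover, if P is a maximal intersecting family, then a permutation p belongs to P if and only if A ⊆ ID(p) for some A ∈ A; in particular P = P(A). -/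
theorem Equiv.Perm.eq_one_of_strictMono {n : ℕ} {e : Equiv.Perm (Fin n)} (h : StrictMono e) :
    e = 1 := by
  have he : StrictMono.orderIsoOfSurjective e h e.surjective = OrderIso.refl (Fin n) :=
    Subsingleton.elim _ _
  ext x
  exact congrArg Fin.val (DFunLike.congr_fun he x)

theorem InvSet_injective (n : ℕ) : Function.Injective (InvSet n) := by
  intro p q h
  have key : ∀ a b : Fin n, a < b → (p.symm b < p.symm a ↔ q.symm b < q.symm a) := by
    intro a b hab
    have := Finset.ext_iff.1 h (a, b)
    simpa [mem_InvSet, hab] using this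
  have hmono : StrictMono (p.trans q.symm) := by
    intro x y hxy
    simp only [Equiv.trans_apply]
    rcases lt_trichotomy (p x) (p y) with h1 | h1 | h1
    · have h2 := (key _ _ h1).not.1 (by simpa using hxy.le)
      exact lt_of_le_of_ne (not_lt.1 h2) (fun h3 => h1.ne (q.symm.injective h3))
    · exact absurd (p.injective h1) hxy.ne
    · exact (key _ _ h1).1 (by simpa using hxy)
  have h1 := Equiv.Perm.eq_one_of_strictMono hmono
  ext x
  have h2 : q.symm (p x) = x := DFunLike.congr_fun h1 x
  rw [Equiv.symm_apply_eq] at h2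
  rw [h2]

theorem mem_ID {n i : ℕ} {p : Equiv.Perm (Fin n)} :
    i ∈ ID n p ↔ ∃ a b : Fin n, (a : ℕ) + 1 = i ∧ (b : ℕ) = i ∧ (a, b) ∈ InvSet n p := by
  simp only [ID, Finset.mem_filter, Finset.mem_Icc, mem_InvSet, Fin.lt_def]
  constructor
  · rintro ⟨-, a, b, ha, hb, h⟩
    exact ⟨a, b, ha, hb, by omega, h⟩
  · rintro ⟨a, b, ha, hb, -, h⟩
    exact ⟨by omega, a, b, ha, hb, h⟩

theorem ID_nonempty {n : ℕ} {p : Equiv.Perm (Fin n)} (hp : p ≠ 1) : (ID n p).Nonempty := by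
  by_contra hne
  apply hp
  have hmono : StrictMono p.symm := by
    cases n with
    | zero => exact fun x => x.elim0
    | succ m =>
      refine Fin.strictMono_iff_lt_succ.2 fun i => ?_
      by_contra hlt
      refine hne ⟨i + 1, mem_ID.2 ⟨i.castSucc, i.succ, by simp, by simp, ?_⟩⟩
      refine mem_InvSet.2 ⟨i.castSucc_lt_succ, lt_of_le_of_ne (not_lt.1 hlt) fun h => ?_⟩
      exact i.castSucc_lt_succ.ne' (p.symm.injective h)
  have h1 := Equiv.Perm.eq_one_of_strictMono hmono
  ext x
  have h2 : p.symm x = x := DFunLike.congr_fun h1 x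
  rw [Equiv.symm_apply_eq] at h2
  rw [← h2]
  rfl

/-- Two permutations have a common lower bound other than the identity iff their inverse
descent sets meet. -/
theorem exists_common_lower_bound_iff {n : ℕ} {p q : Equiv.Perm (Fin n)} :
    (∃ r : Equiv.Perm (Fin n), r ≠ 1 ∧ BLE r p ∧ BLE r q) ↔ (ID n p ∩ ID n q).Nonempty := by
  constructor
  · rintro ⟨r, hr, hp, hq⟩
    exact (ID_nonempty hr).mono (Finset.subset_inter (ID_mono hp) (ID_mono hq))
  · rintro ⟨i, hi⟩
    obtain ⟨hip, hiq⟩ := Finset.mem_inter.1 hi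
    obtain ⟨a, b, ha, hb, hp⟩ := mem_ID.1 hip
    obtain ⟨a', b', ha', hb', hq⟩ := mem_ID.1 hiq
    obtain rfl : a' = a := Fin.ext (by omega)
    obtain rfl : b' = b := Fin.ext (by omega)
    have hswap : ∀ x ∈ InvSet n (Equiv.swap a' b'), x = (a', b') := by
      rintro ⟨x, y⟩ h
      rw [mem_InvSet, Equiv.symm_swap, Equiv.swap_apply_def, Equiv.swap_apply_def] at h
      rw [Prod.mk.injEq]
      split_ifs at h <;> simp only [Fin.ext_iff, Fin.lt_def] at * <;> omega
    refine ⟨Equiv.swap a' b', ?_, ?_, ?_⟩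
    · rw [Ne, Equiv.Perm.one_def, Equiv.swap_eq_refl_iff]
      exact (mem_InvSet.1 hp).1.ne
    · intro x hx
      rw [hswap x hx]
      exact hp
    · intro x hx
      rw [hswap x hx]
      exact hq

theorem exists_minSet_BLE {n : ℕ} {P : Set (Equiv.Perm (Fin n))} {p : Equiv.Perm (Fin n)}
    (hp : p ∈ P) : ∃ q ∈ minSet n P, BLE q p := by
  obtain ⟨q, ⟨hqP, hqp⟩, hmin⟩ := Set.exists_min_image {q | q ∈ P ∧ BLE q p}
    (fun q => (InvSet n q).card) (Set.toFinite _) ⟨p, hp, Finset.Subset.refl _⟩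
  refine ⟨q, ⟨hqP, fun r hr hrq => InvSet_injective n ?_⟩, hqp⟩
  exact Finset.eq_of_subset_of_card_le hrq (hmin r ⟨hr, Finset.Subset.trans hrq hqp⟩)


/-- Let `P ⊆ B(n)` be intersecting and `𝒜 = {ID(p) : p ∈ min(P)}`. Then `𝒜` is an
intersecting set system; moreover, if `P` is a maximal intersecting family, then
`p ∈ P` iff `A ⊆ ID(p)` for some `A ∈ 𝒜`; in particular `P = P(𝒜)`. -/
theorem stmt_10 (n : ℕ) (P : Set (Equiv.Perm (Fin n))) (hP : BInter n P) :
    (∀ s ∈ genSys n P, ∀ t ∈ genSys n P, (s ∩ t).Nonempty) ∧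
    (MaxBInter n P →
      (∀ p : Equiv.Perm (Fin n), p ∈ P ↔ ∃ A ∈ genSys n P, A ⊆ ID n p) ∧
      P = PofSystem n (genSys n P)) := by
  refine ⟨?_, fun hmax => ?_⟩
  · rintro _ ⟨p, hp, rfl⟩ _ ⟨q, hq, rfl⟩
    exact exists_common_lower_bound_iff.1 (hP p hp.1 q hq.1)
  · have hmem : ∀ p : Equiv.Perm (Fin n), p ∈ P ↔ ∃ A ∈ genSys n P, A ⊆ ID n p := by
      intro p
      constructor
      · intro hp
        obtain ⟨q, hq, hqp⟩ := exists_minSet_BLE hp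
        exact ⟨ID n q, ⟨q, hq, rfl⟩, ID_mono hqp⟩
      · rintro ⟨_, ⟨q, hq, rfl⟩, hqp⟩
        refine hmax.2 p fun r hr => exists_common_lower_bound_iff.2 ?_
        exact (exists_common_lower_bound_iff.1 (hP q hq.1 r hr)).mono
          (Finset.inter_subset_inter_right hqp)
    exact ⟨hmem, Set.ext hmem⟩
end

section
/- Let n ≥ 2, let G = {1,…,n−1}, and let integers k, r satisfy 1 ≤ k ≤ r < (|G|−1)/2. Let H_{r,k} = {H ⊆ G : |H| = r and |H ∩ {1,…,2k−1}| ≥ k}, and let H be the image of H_{r,k} under any bijection of G. If k = r, then |P(H)| = n!/2, while if k < r, then |P(H)| < n!/2. -/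
theorem mem_ID_iff {n i : ℕ} (p : Equiv.Perm (Fin n)) (h1 : 1 ≤ i) (h2 : i < n) :
    i ∈ ID n p ↔ p.symm ⟨i, h2⟩ < p.symm ⟨i - 1, by omega⟩ := by
  simp only [ID, Finset.mem_filter, Finset.mem_Icc]
  constructor
  · rintro ⟨-, a, b, ha, hb, h⟩
    have ha' : a = ⟨i - 1, by omega⟩ := Fin.ext (by simp; omega)
    have hb' : b = ⟨i, h2⟩ := Fin.ext hb
    rwa [← ha', ← hb']
  · intro h
    exact ⟨⟨h1, by omega⟩, _, _, by simp; omega, rfl, h⟩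

theorem ID_subset (n : ℕ) (p : Equiv.Perm (Fin n)) : ID n p ⊆ Finset.Icc 1 (n - 1) :=
  Finset.filter_subset _ _

/-- Reversing the one-line notation complements the inverse descent set. -/
theorem ID_mul_revPerm (n : ℕ) (p : Equiv.Perm (Fin n)) :
    ID n (p * Fin.revPerm) = Finset.Icc 1 (n - 1) \ ID n p := by
  ext i
  by_cases hi : i ∈ Finset.Icc 1 (n - 1)
  · have hi' := Finset.mem_Icc.mp hi
    have h2 : i < n := by omega
    rw [Finset.mem_sdiff, mem_ID_iff _ hi'.1 h2, mem_ID_iff _ hi'.1 h2]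
    have hne : p.symm ⟨i, h2⟩ ≠ p.symm ⟨i - 1, by omega⟩ := by
      intro h
      have := congrArg Fin.val (p.symm.injective h)
      simp only at this
      omega
    have hs : ∀ x, (p * Fin.revPerm).symm x = Fin.rev (p.symm x) := fun x => rfl
    rw [hs, hs, Fin.rev_lt_rev]
    exact ⟨fun h => ⟨hi, h.not_gt⟩, fun h => lt_of_le_of_ne (not_lt.mp h.2) hne.symm⟩
  · exact iff_of_false (fun h => hi (ID_subset _ _ h)) (fun h => hi (Finset.mem_sdiff.mp h).1)

/-- Every subset of `{1,…,n-1}` is an inverse descent set. -/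
theorem exists_ID_eq (n : ℕ) (S : Finset ℕ) (hS : S ⊆ Finset.Icc 1 (n - 1)) :
    ∃ p : Equiv.Perm (Fin n), ID n p = S := by
  let c : ℕ → ℕ := fun i => (S.filter (· ≤ i)).card
  let f : Fin n → ℤ := fun i => (i : ℤ) - n * c i
  have hc : Monotone c := fun i j hij => Finset.card_le_card fun x hx => by
    simp only [Finset.mem_filter] at hx ⊢
    exact ⟨hx.1, hx.2.trans hij⟩
  have hlt : ∀ i j : Fin n, c i < c j → f j < f i := by
    intro i j h
    have h' : (c i : ℤ) + 1 ≤ c j := by exact_mod_cast h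
    have := j.isLt
    have := mul_le_mul_of_nonneg_left h' (Int.natCast_nonneg n)
    simp only [f]
    rw [mul_add] at this
    omega
  have hf : Function.Injective f := by
    intro i j h
    rcases lt_trichotomy (c i) (c j) with hl | he | hl
    · exact absurd h (hlt i j hl).ne'
    · simp only [f, he] at h
      exact Fin.ext (by omega)
    · exact absurd h (hlt j i hl).ne
  have hmono : StrictMono (f ∘ Tuple.sort f) :=
    (Tuple.monotone_sort f).strictMono_of_injective (hf.comp (Tuple.sort f).injective)
  have hsymm : ∀ a b, (Tuple.sort f).symm a < (Tuple.sort f).symm b ↔ f a < f b := by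
    intro a b
    rw [← hmono.lt_iff_lt]
    simp
  refine ⟨Tuple.sort f, ?_⟩
  ext i
  by_cases hi : i ∈ Finset.Icc 1 (n - 1)
  · have hi' := Finset.mem_Icc.mp hi
    have h2 : i < n := by omega
    rw [mem_ID_iff _ hi'.1 h2, hsymm]
    constructor
    · intro h
      by_contra hiS
      have hcc : c i = c (i - 1) := by
        refine congrArg Finset.card (Finset.filter_congr fun x hx => ?_)
        have : x ≠ i := fun h => hiS (h ▸ hx)
        omega
      simp only [f, hcc] at h
      omega
    · intro hiS
      refine hlt _ _ (Finset.card_lt_card ?_)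
      rw [Finset.ssubset_iff_of_subset]
      · refine ⟨i, by simp [hiS], ?_⟩
        simp only [Finset.mem_filter, not_and, not_le]
        omega
      · intro x hx
        simp only [Finset.mem_filter] at hx ⊢
        exact ⟨hx.1, by omega⟩
  · exact iff_of_false (fun h => hi (ID_subset _ _ h)) (fun h => hi (hS h))

theorem mem_PofSystem_image_iff {n k r : ℕ} (hkr : k ≤ r) {σ : ℕ → ℕ}
    (hσ : Set.BijOn σ (↑(Finset.Icc 1 (n - 1)) : Set ℕ) (↑(Finset.Icc 1 (n - 1)) : Set ℕ))
    {T : Finset ℕ} (hTG : T ⊆ Finset.Icc 1 (n - 1)) (p : Equiv.Perm (Fin n)) :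
    p ∈ PofSystem n {s | ∃ H : Finset ℕ, (H ⊆ Finset.Icc 1 (n - 1) ∧ H.card = r ∧
        k ≤ (H ∩ T).card) ∧ s = H.image σ} ↔
      k ≤ (ID n p ∩ T.image σ).card ∧ r ≤ (ID n p).card := by
  have hcard : ∀ A ⊆ Finset.Icc 1 (n - 1), (A.image σ).card = A.card := fun A hA =>
    Finset.card_image_of_injOn (hσ.injOn.mono (Finset.coe_subset.mpr hA))
  constructor
  · rintro ⟨_, ⟨H, ⟨hH, hHr, hHk⟩, rfl⟩, hsub⟩
    refine ⟨?_, ?_⟩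
    · rw [← hcard _ (Finset.inter_subset_left.trans hH)] at hHk
      refine hHk.trans (Finset.card_le_card ((Finset.image_inter_subset σ H T).trans ?_))
      exact Finset.inter_subset_inter_right hsub
    · rw [← hHr, ← hcard H hH]
      exact Finset.card_le_card hsub
  · rintro ⟨hk, hr⟩
    let A := (Finset.Icc 1 (n - 1)).filter fun x => σ x ∈ ID n p
    have hAG : A ⊆ Finset.Icc 1 (n - 1) := Finset.filter_subset _ _
    have hA : A.image σ = ID n p := by
      ext y
      simp only [A, Finset.mem_image, Finset.mem_filter]
      constructor
      · rintro ⟨x, ⟨-, hx⟩, rfl⟩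
        exact hx
      · intro hy
        obtain ⟨x, hx, rfl⟩ := hσ.surjOn (Finset.mem_coe.mpr (ID_subset n p hy))
        exact ⟨x, ⟨Finset.mem_coe.mp hx, hy⟩, rfl⟩
    have hAT : ID n p ∩ T.image σ ⊆ (A ∩ T).image σ := by
      intro y hy
      obtain ⟨hy, hyT⟩ := Finset.mem_inter.mp hy
      obtain ⟨x, hx, rfl⟩ := Finset.mem_image.mp hyT
      exact Finset.mem_image_of_mem _ (Finset.mem_inter.mpr
        ⟨Finset.mem_filter.mpr ⟨hTG hx, hy⟩, hx⟩)
    have hkA : k ≤ (A ∩ T).card := by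
      rw [← hcard _ (Finset.inter_subset_left.trans hAG)]
      exact hk.trans (Finset.card_le_card hAT)
    obtain ⟨U, hU, hUc⟩ := Finset.exists_subset_card_eq hkA
    rw [← hA, hcard A hAG] at hr
    obtain ⟨H, hUH, hHA, hHc⟩ := Finset.exists_subsuperset_card_eq
      (hU.trans Finset.inter_subset_left) (hUc.trans_le hkr) hr
    refine ⟨H.image σ, ⟨H, ⟨hHA.trans hAG, hHc, ?_⟩, rfl⟩, ?_⟩
    · rw [← hUc]
      exact Finset.card_le_card (Finset.subset_inter hUH (hU.trans Finset.inter_subset_right))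
    · rw [← hA]
      exact Finset.image_subset_image hHA

/-- For a set of odd size `2 * k - 1`, exactly half of all permutations have a majority of it
among their inverse descents. -/
theorem two_mul_card_majority {n k : ℕ} (hk : 1 ≤ k) {T : Finset ℕ}
    (hT : T ⊆ Finset.Icc 1 (n - 1)) (hTc : T.card = 2 * k - 1) :
    2 * (Finset.univ.filter fun p : Equiv.Perm (Fin n) => k ≤ (ID n p ∩ T).card).card =
      n.factorial := by
  have key : ∀ p : Equiv.Perm (Fin n),
      k ≤ (ID n (p * Fin.revPerm) ∩ T).card ↔ ¬ k ≤ (ID n p ∩ T).card := by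
    intro p
    have h1 : ID n (p * Fin.revPerm) ∩ T = T \ ID n p := by
      rw [ID_mul_revPerm]
      ext x
      simp only [Finset.mem_inter, Finset.mem_sdiff]
      exact ⟨fun h => ⟨h.2, h.1.2⟩, fun h => ⟨⟨hT h.1, h.2⟩, h.1⟩⟩
    have h2 := Finset.card_sdiff_add_card_inter T (ID n p)
    rw [Finset.inter_comm T] at h2
    rw [h1]
    omega
  have h1 : (Finset.univ.filter fun p : Equiv.Perm (Fin n) => k ≤ (ID n p ∩ T).card).card =
      (Finset.univ.filter fun p : Equiv.Perm (Fin n) => ¬ k ≤ (ID n p ∩ T).card).card := by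
    refine Finset.card_equiv (Equiv.mulRight Fin.revPerm) fun p => ?_
    simp only [Finset.mem_filter, Finset.mem_univ, true_and, Equiv.coe_mulRight, key, not_not]
  have h2 := Finset.card_filter_add_card_filter_not (s := Finset.univ)
    (fun p : Equiv.Perm (Fin n) => k ≤ (ID n p ∩ T).card)
  rw [Finset.card_univ, Fintype.card_perm, Fintype.card_fin] at h2
  omega

/-- Let `G = {1,…,n-1}` and `1 ≤ k ≤ r < (|G|-1)/2`. Let `H` be the image of
`H_{r,k} = {H ⊆ G : |H| = r, |H ∩ {1,…,2k-1}| ≥ k}` under a bijection of `G`.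
If `k = r` then `|P(H)| = n!/2`, while if `k < r` then `|P(H)| < n!/2`. -/
theorem stmt_14 (n k r : ℕ) (hn : 2 ≤ n) (hk : 1 ≤ k) (hkr : k ≤ r)
    (hr : 2 * r < n - 1 - 1) (σ : ℕ → ℕ)
    (hσ : Set.BijOn σ (↑(Finset.Icc 1 (n - 1)) : Set ℕ) (↑(Finset.Icc 1 (n - 1)) : Set ℕ)) :
    (k = r → Nat.card (PofSystem n
      {s | ∃ H : Finset ℕ, (H ⊆ Finset.Icc 1 (n - 1) ∧ H.card = r ∧
        k ≤ (H ∩ Finset.Icc 1 (2 * k - 1)).card) ∧ s = H.image σ}) =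
          Nat.factorial n / 2) ∧
    (k < r → Nat.card (PofSystem n
      {s | ∃ H : Finset ℕ, (H ⊆ Finset.Icc 1 (n - 1) ∧ H.card = r ∧
        k ≤ (H ∩ Finset.Icc 1 (2 * k - 1)).card) ∧ s = H.image σ}) <
          Nat.factorial n / 2) := by
  have hTG : Finset.Icc 1 (2 * k - 1) ⊆ Finset.Icc 1 (n - 1) :=
    Finset.Icc_subset_Icc_right (by omega)
  set T := (Finset.Icc 1 (2 * k - 1)).image σ with hTdef
  have hT : T ⊆ Finset.Icc 1 (n - 1) := by
    intro y hy
    obtain ⟨x, hx, rfl⟩ := Finset.mem_image.mp hy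
    exact Finset.mem_coe.mp (hσ.mapsTo (Finset.mem_coe.mpr (hTG hx)))
  have hTc : T.card = 2 * k - 1 := by
    rw [hTdef, Finset.card_image_of_injOn (hσ.injOn.mono (Finset.coe_subset.mpr hTG))]
    simp
  have hP : PofSystem n {s | ∃ H : Finset ℕ, (H ⊆ Finset.Icc 1 (n - 1) ∧ H.card = r ∧
        k ≤ (H ∩ Finset.Icc 1 (2 * k - 1)).card) ∧ s = H.image σ} =
      ↑(Finset.univ.filter fun p : Equiv.Perm (Fin n) =>
        k ≤ (ID n p ∩ T).card ∧ r ≤ (ID n p).card) := by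
    ext p
    rw [mem_PofSystem_image_iff hkr hσ hTG]
    simp [hTdef]
  have hhalf := two_mul_card_majority hk hT hTc
  rw [hP, Nat.card_coe_set_eq, Set.ncard_coe_finset]
  constructor
  · rintro rfl
    have : (Finset.univ.filter fun p : Equiv.Perm (Fin n) =>
        k ≤ (ID n p ∩ T).card ∧ k ≤ (ID n p).card) =
        Finset.univ.filter fun p : Equiv.Perm (Fin n) => k ≤ (ID n p ∩ T).card :=
      Finset.filter_congr fun p _ => and_iff_left_of_imp fun h =>
        h.trans (Finset.card_le_card Finset.inter_subset_left)
    rw [this]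
    omega
  · intro hlt
    obtain ⟨S, hST, hSc⟩ := Finset.exists_subset_card_eq (s := T) (n := k) (by omega)
    obtain ⟨p, hp⟩ := exists_ID_eq n S (hST.trans hT)
    have : (Finset.univ.filter fun p : Equiv.Perm (Fin n) =>
        k ≤ (ID n p ∩ T).card ∧ r ≤ (ID n p).card).card <
        (Finset.univ.filter fun p : Equiv.Perm (Fin n) => k ≤ (ID n p ∩ T).card).card := by
      refine Finset.card_lt_card ((Finset.ssubset_iff_of_subset
        (Finset.monotone_filter_right _ fun _ _ h => h.1)).mpr ⟨p, ?_, ?_⟩)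
      · simp [hp, Finset.inter_eq_left.mpr hST, hSc]
      · simp [hp, hSc, hlt]
    omega
end
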